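/- Let W₁, W₂ : ℝ → ℝ be smooth real-valued functions. The curvature R_{μν} := ∂_μ ω_ν − ∂_ν ω_μ + ω_μ ω_ν − ω_ν ω_μ of the TRW connection vanishes identically on U if and only if either (i) W₁ ≡ 0 and a(t)² W₂(t)² = k for all t (possible only for k ≥ 0, i.e. W₂ = ±√k / a), or (ii) W₂ ≡ 0 and a(t)² W₁(t)² = −k for all t (possible only for k ≤ 0, i.e. W₁ = ±√(−k) / a). -/

import Mathlib

/-!
STATEMENT 2: The curvature R_{μν} = ∂_μ ω_ν − ∂_ν ω_μ + ω_μ ω_ν − ω_ν ω_μ of the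
TRW connection vanishes identically on
U = {(t,r,θ,φ) : r > 0, 0 < θ < π, 1 − k r² > 0}
if and only if either (i) W₁ ≡ 0 and a(t)² W₂(t)² = k for all t, or
(ii) W₂ ≡ 0 and a(t)² W₁(t)² = −k for all t.

Coordinates: x : Fin 4 → ℝ with t = x 0, r = x 1, θ = x 2, φ = x 3; χ = √(1 − k r²);
ω_μ is the 4×4 matrix (ω^a_{bμ}) of the TRW connection with frame indices raised by
η = diag(−1,1,1,1).
-/

open Real
open scoped ContDiff

noncomputable section

/-- Partial derivative in the μ-th coordinate direction. -/
def pd (μ : Fin 4) (f : (Fin 4 → ℝ) → ℝ) (x : Fin 4 → ℝ) : ℝ :=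
  fderiv ℝ f x (Pi.single μ 1)

/-- The matrices ω_μ = (ω^a_{bμ}) of the TRW connection: ω_t = 0 and the matrices
ω_r, ω_θ, ω_φ obtained from the antisymmetric one-forms
ω_{12} = W₁(a/χ) dr, ω_{13} = W₁ a r dθ, ω_{14} = W₁ a r sinθ dφ,
ω_{23} = −χ dθ + W₂ a r sinθ dφ, ω_{24} = −W₂ a r dθ − χ sinθ dφ,
ω_{34} = W₂(a/χ) dr − cosθ dφ, via ω^a_{bμ} = η^{ac} ω_{cbμ}. -/
def omegaTRW (k : ℝ) (a W₁ W₂ : ℝ → ℝ) (μ : Fin 4) (x : Fin 4 → ℝ) :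
    Matrix (Fin 4) (Fin 4) ℝ :=
  let t := x 0
  let r := x 1
  let θ := x 2
  let χ := Real.sqrt (1 - k * r ^ 2)
  ![(0 : Matrix (Fin 4) (Fin 4) ℝ),
    !![0, -(W₁ t * a t / χ), 0, 0;
       -(W₁ t * a t / χ), 0, 0, 0;
       0, 0, 0, W₂ t * a t / χ;
       0, 0, -(W₂ t * a t / χ), 0],
    !![0, 0, -(W₁ t * a t * r), 0;
       0, 0, -χ, -(W₂ t * a t * r);
       -(W₁ t * a t * r), χ, 0, 0;
       0, W₂ t * a t * r, 0, 0],
    !![0, 0, 0, -(W₁ t * a t * r * Real.sin θ);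
       0, 0, W₂ t * a t * r * Real.sin θ, -(χ * Real.sin θ);
       0, -(W₂ t * a t * r * Real.sin θ), 0, -Real.cos θ;
       -(W₁ t * a t * r * Real.sin θ), χ * Real.sin θ, Real.cos θ, 0]] μ

/-- Curvature R_{μν} = ∂_μ ω_ν − ∂_ν ω_μ + ω_μ ω_ν − ω_ν ω_μ of the TRW connection. -/
def curvTRW (k : ℝ) (a W₁ W₂ : ℝ → ℝ) (μ ν : Fin 4) (x : Fin 4 → ℝ) :
    Matrix (Fin 4) (Fin 4) ℝ :=
  Matrix.of fun i j =>
    pd μ (fun y => omegaTRW k a W₁ W₂ ν y i j) x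
      - pd ν (fun y => omegaTRW k a W₁ W₂ μ y i j) x
      + (omegaTRW k a W₁ W₂ μ x * omegaTRW k a W₁ W₂ ν x
          - omegaTRW k a W₁ W₂ ν x * omegaTRW k a W₁ W₂ μ x) i j

theorem pd_of {f : (Fin 4 → ℝ) → ℝ} {u v du dv : ℝ} {x : Fin 4 → ℝ} (μ : Fin 4)
    (h : HasFDerivAt f (du • (v • ContinuousLinearMap.proj (R := ℝ) (φ := fun _ : Fin 4 => ℝ) 1)
      + dv • (u • ContinuousLinearMap.proj (R := ℝ) (φ := fun _ : Fin 4 => ℝ) 2)) x) :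
    pd μ f x = (if μ = 1 then du * v else 0) + (if μ = 2 then dv * u else 0) := by
  unfold pd
  rw [h.fderiv]
  fin_cases μ <;> simp [Pi.single_apply]

theorem pd_mul {U V : ℝ → ℝ} {du dv : ℝ} {x : Fin 4 → ℝ} (μ : Fin 4)
    (hu : HasDerivAt U du (x 1)) (hv : HasDerivAt V dv (x 2)) :
    pd μ (fun y => U (y 1) * V (y 2)) x =
      (if μ = 1 then du * V (x 2) else 0) + (if μ = 2 then dv * U (x 1) else 0) := by
  apply pd_of
  have h1 : HasFDerivAt (fun y : Fin 4 → ℝ => y 1)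
    (ContinuousLinearMap.proj (R := ℝ) (φ := fun _ : Fin 4 => ℝ) 1) x := hasFDerivAt_apply 1 x
  have h2 : HasFDerivAt (fun y : Fin 4 → ℝ => y 2)
    (ContinuousLinearMap.proj (R := ℝ) (φ := fun _ : Fin 4 => ℝ) 2) x := hasFDerivAt_apply 2 x
  have := (hu.comp_hasFDerivAt x h1).mul (hv.comp_hasFDerivAt x h2)
  refine this.congr_fderiv ?_
  ext y
  simp
  ring

theorem pd_const_fun (μ : Fin 4) (c : ℝ) (x : Fin 4 → ℝ) : pd μ (fun _ => c) x = 0 := by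
  simp [pd]

theorem pd_neg_fun (μ : Fin 4) (f : (Fin 4 → ℝ) → ℝ) (x : Fin 4 → ℝ) :
    pd μ (fun y => -f y) x = -pd μ f x := by
  simp [pd, fderiv_fun_neg]

theorem hasDeriv_chi {k r : ℝ} (h : 0 < 1 - k * r ^ 2) :
    HasDerivAt (fun r => √(1 - k * r ^ 2)) (-(k * r) / √(1 - k * r ^ 2)) r := by
  have h1 : HasDerivAt (fun r : ℝ => 1 - k * r ^ 2) (-(k * (2 * r))) r := by
    simpa using ((hasDerivAt_pow 2 r).const_mul k).const_sub 1
  refine (h1.sqrt h.ne').congr_deriv ?_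
  have := (Real.sqrt_pos.2 h).ne'
  field_simp

theorem pd_chi {k : ℝ} (μ : Fin 4) {x : Fin 4 → ℝ} (h : 0 < 1 - k * (x 1) ^ 2) :
    pd μ (fun y => √(1 - k * (y 1) ^ 2)) x =
      if μ = 1 then -(k * x 1) / √(1 - k * (x 1) ^ 2) else 0 := by
  simpa using pd_mul μ (hasDeriv_chi h) (hasDerivAt_const (x 2) (1 : ℝ))

theorem pd_chi_sin {k : ℝ} (μ : Fin 4) {x : Fin 4 → ℝ} (h : 0 < 1 - k * (x 1) ^ 2) :
    pd μ (fun y => √(1 - k * (y 1) ^ 2) * Real.sin (y 2)) x =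
      (if μ = 1 then -(k * x 1) / √(1 - k * (x 1) ^ 2) * Real.sin (x 2) else 0)
      + (if μ = 2 then Real.cos (x 2) * √(1 - k * (x 1) ^ 2) else 0) :=
  pd_mul μ (hasDeriv_chi h) (Real.hasDerivAt_sin (x 2))

theorem pd_lin (c : ℝ) (μ : Fin 4) (x : Fin 4 → ℝ) :
    pd μ (fun y => c * y 1) x = if μ = 1 then c else 0 := by
  have h : HasDerivAt (fun r : ℝ => c * r) c (x 1) := by
    simpa using (hasDerivAt_id (x 1)).const_mul c
  simpa using pd_mul μ h (hasDerivAt_const (x 2) (1 : ℝ))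

theorem pd_lin_sin (c : ℝ) (μ : Fin 4) (x : Fin 4 → ℝ) :
    pd μ (fun y => c * y 1 * Real.sin (y 2)) x =
      (if μ = 1 then c * Real.sin (x 2) else 0)
      + (if μ = 2 then Real.cos (x 2) * (c * x 1) else 0) := by
  have h : HasDerivAt (fun r : ℝ => c * r) c (x 1) := by
    simpa using (hasDerivAt_id (x 1)).const_mul c
  exact pd_mul μ h (Real.hasDerivAt_sin (x 2))

theorem pd_cos (μ : Fin 4) (x : Fin 4 → ℝ) :
    pd μ (fun y => Real.cos (y 2)) x = if μ = 2 then -Real.sin (x 2) else 0 := by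
  simpa using pd_mul μ (hasDerivAt_const (x 1) (1 : ℝ)) (Real.hasDerivAt_cos (x 2))

theorem pd_div_chi {k : ℝ} (c : ℝ) (μ : Fin 4) {x : Fin 4 → ℝ} (h : 0 < 1 - k * (x 1) ^ 2) :
    pd μ (fun y => c / √(1 - k * (y 1) ^ 2)) x =
      if μ = 1 then c * (k * x 1) / √(1 - k * (x 1) ^ 2) ^ 3 else 0 := by
  have hp := (Real.sqrt_pos.2 h).ne'
  have h1 : HasDerivAt (fun r => c / √(1 - k * r ^ 2))
      (c * (k * x 1) / √(1 - k * (x 1) ^ 2) ^ 3) (x 1) := by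
    refine ((hasDerivAt_const (x 1) c).fun_div (hasDeriv_chi h) hp).congr_deriv ?_
    field_simp
    ring
  simpa using pd_mul μ h1 (hasDerivAt_const (x 2) (1 : ℝ))

theorem curv_antisymm (k : ℝ) (a W₁ W₂ : ℝ → ℝ) (μ ν : Fin 4) (x : Fin 4 → ℝ) :
    curvTRW k a W₁ W₂ μ ν x = -curvTRW k a W₁ W₂ ν μ x := by
  ext i j
  simp [curvTRW]
  ring

set_option maxHeartbeats 4000000 in
theorem curv_const (k c d : ℝ) (a W₁ W₂ : ℝ → ℝ) (h1 : ∀ t, W₁ t * a t = c)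
    (h2 : ∀ t, W₂ t * a t = d) (hcd : c * d = 0) (hk : k = d ^ 2 - c ^ 2)
    (x : Fin 4 → ℝ) (hx : 0 < 1 - k * (x 1) ^ 2) (μ ν : Fin 4) :
    curvTRW k a W₁ W₂ μ ν x = 0 := by
  have key : ∀ μ ν : Fin 4, μ < ν → curvTRW k a W₁ W₂ μ ν x = 0 := by
    intro μ ν hlt
    have hp := (Real.sqrt_pos.2 hx).ne'
    have hsq := Real.sq_sqrt hx.le
    have hsc := Real.sin_sq_add_cos_sq (x 2)
    ext i j
    fin_cases μ <;> fin_cases ν <;> first | (exfalso; revert hlt; decide) | skip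
    all_goals
      fin_cases i <;> fin_cases j <;>
      simp [curvTRW, omegaTRW, h1, h2, pd_const_fun, pd_neg_fun, pd_chi, pd_chi_sin, pd_lin, pd_lin_sin,
        pd_cos, pd_div_chi, hx, Matrix.mul_apply, Fin.sum_univ_four]
    all_goals
      generalize √(1 - k * (x 1) ^ 2) = X at *
      try field_simp
      try grind
  rcases lt_trichotomy μ ν with h | h | h
  · exact key μ ν h
  · subst h
    ext i j
    simp [curvTRW]
  · rw [curv_antisymm, key ν μ h, neg_zero]

theorem const_of_sq {F : ℝ → ℝ} (hF : ContDiff ℝ ∞ F) {m : ℝ} (h : ∀ t, F t ^ 2 = m) :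
    ∀ t, F t = F 0 := by
  have hd : Differentiable ℝ F := hF.differentiable (by simp)
  intro t
  refine is_const_of_deriv_eq_zero hd (fun s => ?_) t 0
  by_cases hm : m = 0
  · have : F = fun _ => 0 := by
      funext t
      have := h t
      rw [hm] at this
      exact pow_eq_zero_iff (two_ne_zero) |>.1 this
    rw [this]; simp
  · have h1 := ((hd s).hasDerivAt.pow 2).unique
      (by
        have : F ^ 2 = fun _ => m := by funext t; exact h t
        rw [this]; exact hasDerivAt_const s m)
    have h0 : F s ≠ 0 := by
      intro h0
      apply hm
      rw [← h s, h0]; simp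
    simpa [h0] using h1

theorem exists_r (k : ℝ) : ∃ r : ℝ, 0 < r ∧ 0 < 1 - k * r ^ 2 := by
  have hb : 0 < 1 + |k| := by positivity
  refine ⟨1 / (1 + |k|), by positivity, ?_⟩
  have h1 := le_abs_self k
  have h0 := abs_nonneg k
  have : k * (1 / (1 + |k|)) ^ 2 < 1 := by
    rw [div_pow, one_pow, mul_one_div, div_lt_one (by positivity)]
    nlinarith
  linarith

theorem flat_alg (k : ℝ) (a W₁ W₂ : ℝ → ℝ)
    (H : ∀ x : Fin 4 → ℝ, 0 < x 1 → 0 < x 2 → x 2 < Real.pi → 0 < 1 - k * (x 1) ^ 2 →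
        ∀ μ ν : Fin 4, curvTRW k a W₁ W₂ μ ν x = 0) (t : ℝ) :
    (W₁ t * a t) * (W₂ t * a t) = 0 ∧ k = (W₂ t * a t) ^ 2 - (W₁ t * a t) ^ 2 := by
  obtain ⟨r, hr, hx⟩ := exists_r k
  have hc := H ![t, r, Real.pi / 2, 0] (by simpa using hr) (by simp [Real.pi_pos])
    (by simp [Real.pi_pos]) (by simpa using hx) 1 2
  have e1 := congrFun (congrFun hc 0) 3
  have e2 := congrFun (congrFun hc 1) 2
  have hxx : 0 < 1 - k * ((![t, r, Real.pi / 2, 0] : Fin 4 → ℝ) 1) ^ 2 := by simpa using hx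
  have hpc := pd_chi (1 : Fin 4) hxx
  have hp := (Real.sqrt_pos.2 hx).ne'
  simp [curvTRW, omegaTRW, pd_const_fun, pd_neg_fun, Matrix.mul_apply, Fin.sum_univ_four] at e1
  simp [curvTRW, omegaTRW, pd_const_fun, pd_neg_fun, hpc, Matrix.mul_apply, Fin.sum_univ_four] at e2
  generalize √(1 - k * r ^ 2) = X at *
  generalize W₁ t * a t = c at *
  generalize W₂ t * a t = d at *
  field_simp at e1 e2
  constructor
  · grind
  · grind

/-- The curvature of the TRW connection vanishes identically on U if and only if
either W₁ ≡ 0 and a² W₂² = k, or W₂ ≡ 0 and a² W₁² = −k. -/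
theorem TRW_flat_iff (k : ℝ) (a W₁ W₂ : ℝ → ℝ)
    (ha : ContDiff ℝ ∞ a) (hapos : ∀ t, 0 < a t)
    (hW₁ : ContDiff ℝ ∞ W₁) (hW₂ : ContDiff ℝ ∞ W₂) :
    (∀ x : Fin 4 → ℝ, 0 < x 1 → 0 < x 2 → x 2 < Real.pi → 0 < 1 - k * (x 1) ^ 2 →
        ∀ μ ν : Fin 4, curvTRW k a W₁ W₂ μ ν x = 0) ↔
      ((∀ t, W₁ t = 0) ∧ (∀ t, (a t) ^ 2 * (W₂ t) ^ 2 = k)) ∨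
      ((∀ t, W₂ t = 0) ∧ (∀ t, (a t) ^ 2 * (W₁ t) ^ 2 = -k)) := by
  constructor
  · intro H
    have A := flat_alg k a W₁ W₂ H
    rcases lt_trichotomy k 0 with hk | hk | hk
    · right
      have h2 : ∀ t, W₂ t = 0 := by
        intro t
        obtain ⟨e1, e2⟩ := A t
        rcases mul_eq_zero.1 e1 with h | h
        · rw [h] at e2; nlinarith [sq_nonneg (W₂ t * a t)]
        · exact (mul_eq_zero.1 h).resolve_right (hapos t).ne'
      refine ⟨h2, fun t => ?_⟩
      have := (A t).2
      rw [h2 t] at this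
      linarith
    · left
      have h1 : ∀ t, W₁ t = 0 := by
        intro t
        obtain ⟨e1, e2⟩ := A t
        rcases mul_eq_zero.1 e1 with h | h
        · exact (mul_eq_zero.1 h).resolve_right (hapos t).ne'
        · have : W₁ t * a t = 0 := by
            rw [h] at e2
            apply pow_eq_zero_iff two_ne_zero |>.1
            linarith
          exact (mul_eq_zero.1 this).resolve_right (hapos t).ne'
      refine ⟨h1, fun t => ?_⟩
      have := (A t).2
      rw [h1 t] at this
      linarith
    · left
      have h1 : ∀ t, W₁ t = 0 := by
        intro t
        obtain ⟨e1, e2⟩ := A t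
        rcases mul_eq_zero.1 e1 with h | h
        · exact (mul_eq_zero.1 h).resolve_right (hapos t).ne'
        · rw [h] at e2; nlinarith [sq_nonneg (W₁ t * a t)]
      refine ⟨h1, fun t => ?_⟩
      have := (A t).2
      rw [h1 t] at this
      linarith
  · rintro (⟨h, hsq⟩ | ⟨h, hsq⟩) x _ _ _ hx μ ν
    · have e : ∀ t, (W₂ t * a t) ^ 2 = k := fun t => by rw [← hsq t]; ring
      have hc := const_of_sq (hW₂.mul ha) e
      exact curv_const k 0 (W₂ 0 * a 0) a W₁ W₂ (fun t => by simp [h t]) hc (by simp)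
        (by rw [e 0]; ring) x hx μ ν
    · have e : ∀ t, (W₁ t * a t) ^ 2 = -k := fun t => by rw [← hsq t]; ring
      have hc := const_of_sq (hW₁.mul ha) e
      exact curv_const k (W₁ 0 * a 0) 0 a W₁ W₂ hc (fun t => by simp [h t]) (by simp)
        (by rw [e 0]; ring) x hx μ ν


end
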